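/- Fix integers 1 < k < d and suppose B_k ≥ 0 is such that for every n ≥ 1 and every homogeneous function f : {-1,1}^n → ℝ of degree k (i.e., f̂(S) = 0 unless |S| = k), one has ‖f̂‖_{2k/(k+1)} ≤ B_k · max_{x ∈ {-1,1}^n} |f(x)|. Then for every n ≥ 1 and every homogeneous f : {-1,1}^n → ℝ of degree d (i.e., f̂(S) = 0 unless |S| = d), one has ‖f̂‖_{2d/(d+1)} ≤ C(d,k) · B_k · max_{x ∈ {-1,1}^n} |f(x)|, where C(d,k) = ((k+1)/(k−1))^{(d−k)/2} · (1+√2)^d d^d / (k^k (d−k)^{d−k}). -/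

import Mathlib

open Finset

theorem two_mul_mul_le_one_add_rpow_sub_one_sub_rpow {r : ℝ} (hr0 : 0 < r) (hr1 : r < 1) {y : ℝ}
    (hy0 : 0 ≤ y) (hy1 : y ≤ 1) : 2 * r * y ≤ (1 + y) ^ r - (1 - y) ^ r := by
  let φ : ℝ → ℝ := fun y => (1 + y) ^ r - (1 - y) ^ r - 2 * r * y
  have hmono : MonotoneOn φ (Set.Icc 0 1) := by
    refine monotoneOn_of_deriv_nonneg (convex_Icc 0 1) ?_ ?_ ?_
    · refine ContinuousOn.sub (ContinuousOn.sub ?_ ?_) (by fun_prop)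
      · exact ContinuousOn.rpow_const (by fun_prop) fun _ _ => Or.inr hr0.le
      · exact ContinuousOn.rpow_const (by fun_prop) fun _ _ => Or.inr hr0.le
    all_goals rw [interior_Icc]
    all_goals
      have hder : ∀ x ∈ Set.Ioo (0 : ℝ) 1, HasDerivAt φ
          (1 * r * (1 + x) ^ (r - 1) - (-1) * r * (1 - x) ^ (r - 1) - 2 * r * 1) x := by
        intro x hx
        exact ((((hasDerivAt_id x).const_add 1).rpow_const (Or.inl (by simp; linarith [hx.1]))).sub
          (((hasDerivAt_id x).const_sub 1).rpow_const (Or.inl (by simp; linarith [hx.2])))).sub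
          ((hasDerivAt_id x).const_mul (2 * r))
    · exact fun x hx => (hder x hx).differentiableAt.differentiableWithinAt
    · intro x hx
      rw [(hder x hx).deriv]
      have h1 : 0 < 1 + x := by linarith [hx.1]
      have h2 : 0 < 1 - x := by linarith [hx.2]
      set u := (1 + x) ^ (r - 1) with hu
      set v := (1 - x) ^ (r - 1) with hv
      have hu0 : 0 < u := Real.rpow_pos_of_pos h1 _
      have hv0 : 0 < v := Real.rpow_pos_of_pos h2 _
      have huv : 1 ≤ u * v := by
        rw [hu, hv, ← Real.mul_rpow h1.le h2.le]
        exact Real.one_le_rpow_of_pos_of_le_one_of_nonpos (by positivity)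
          (by nlinarith [sq_nonneg x])
          (by linarith)
      have : 2 ≤ u + v := by nlinarith [sq_nonneg (u - v)]
      nlinarith
  have := hmono (Set.left_mem_Icc.2 zero_le_one) ⟨hy0, hy1⟩ hy0
  simp only [φ] at this
  simp at this
  linarith

theorem one_add_mul_sq_le_rpow_add_rpow {p : ℝ} (hp1 : 1 < p) (hp2 : p < 2) {y : ℝ}
    (hy0 : 0 ≤ y) (hy1 : y ≤ 1) :
    1 + p / 2 * ((p - 1) * y ^ 2) ≤ ((1 + y) ^ p + (1 - y) ^ p) / 2 := by
  let φ : ℝ → ℝ := fun y => (1 + y) ^ p + (1 - y) ^ p - p * (p - 1) * y ^ 2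
  have hmono : MonotoneOn φ (Set.Icc 0 1) := by
    refine monotoneOn_of_deriv_nonneg (convex_Icc 0 1) ?_ ?_ ?_
    · refine ContinuousOn.sub (ContinuousOn.add ?_ ?_) (by fun_prop)
      · exact ContinuousOn.rpow_const (by fun_prop) fun _ _ => Or.inr (by linarith)
      · exact ContinuousOn.rpow_const (by fun_prop) fun _ _ => Or.inr (by linarith)
    all_goals rw [interior_Icc]
    all_goals
      have hder : ∀ x ∈ Set.Ioo (0 : ℝ) 1, HasDerivAt φ
          (1 * p * (1 + x) ^ (p - 1) + (-1) * p * (1 - x) ^ (p - 1)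
            - p * (p - 1) * ((2 : ℕ) * x ^ (2 - 1))) x := by
        intro x hx
        exact ((((hasDerivAt_id x).const_add 1).rpow_const (Or.inl (by simp; linarith [hx.1]))).add
          (((hasDerivAt_id x).const_sub 1).rpow_const (Or.inl (by simp; linarith [hx.2])))).sub
          ((hasDerivAt_pow 2 x).const_mul (p * (p - 1)))
    · exact fun x hx => (hder x hx).differentiableAt.differentiableWithinAt
    · intro x hx
      rw [(hder x hx).deriv]
      have := two_mul_mul_le_one_add_rpow_sub_one_sub_rpow (r := p - 1) (by linarith)
        (by linarith) hx.1.le hx.2.le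
      norm_num
      nlinarith
  have := hmono (Set.left_mem_Icc.2 zero_le_one) ⟨hy0, hy1⟩ hy0
  simp only [φ] at this
  norm_num at this
  linarith

/-- The two-point hypercontractive inequality for nonnegative reals. -/
theorem sq_add_mul_sq_rpow_le {p : ℝ} (hp1 : 1 < p) (hp2 : p < 2) {a b : ℝ}
    (ha : 0 ≤ a) (hb : 0 ≤ b) :
    (a ^ 2 + (p - 1) * b ^ 2) ^ (p / 2) ≤ ((a + b) ^ p + |a - b| ^ p) / 2 := by
  have main : ∀ a b : ℝ, 0 ≤ b → b ≤ a →
      (a ^ 2 + (p - 1) * b ^ 2) ^ (p / 2) ≤ ((a + b) ^ p + |a - b| ^ p) / 2 := by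
    intro a b hb hba
    rcases (hb.trans hba).eq_or_lt with h0 | ha
    · obtain rfl : b = 0 := by linarith
      rw [← h0]
      simp [Real.zero_rpow (show p ≠ 0 by linarith), Real.zero_rpow (show p / 2 ≠ 0 by linarith)]
    have hy0 : 0 ≤ b / a := by positivity
    have hy1 : b / a ≤ 1 := (div_le_one ha).2 hba
    have hq : 0 ≤ (p - 1) * (b / a) ^ 2 := mul_nonneg (by linarith) (sq_nonneg _)
    have e1 : a ^ 2 + (p - 1) * b ^ 2 = a ^ 2 * (1 + (p - 1) * (b / a) ^ 2) := by field_simp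
    have e2 : a + b = a * (1 + b / a) := by field_simp
    have e3 : |a - b| = a * (1 - b / a) := by
      rw [abs_of_nonneg (by linarith)]; field_simp
    have e4 : (a ^ 2) ^ (p / 2) = a ^ p := by
      rw [← Real.rpow_natCast, ← Real.rpow_mul ha.le]; congr 1; push_cast; ring
    rw [e1, e2, e3, Real.mul_rpow (sq_nonneg a) (by linarith), e4,
      Real.mul_rpow ha.le (by linarith), Real.mul_rpow ha.le (by linarith)]
    have h1 := rpow_one_add_le_one_add_mul_self (s := (p - 1) * (b / a) ^ 2) (by linarith)
      (p := p / 2) (by linarith) (by linarith)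
    have h2 := one_add_mul_sq_le_rpow_add_rpow hp1 hp2 hy0 hy1
    have h3 := mul_le_mul_of_nonneg_left (h1.trans h2) (Real.rpow_nonneg ha.le p)
    linarith
  rcases le_total b a with h | h
  · exact main a b hb h
  · have := main b a ha h
    rw [add_comm b a, abs_sub_comm] at this
    refine le_trans (Real.rpow_le_rpow ?_ ?_ (by linarith)) this
    · exact add_nonneg (sq_nonneg _) (mul_nonneg (by linarith) (sq_nonneg _))
    · nlinarith [pow_le_pow_left₀ ha h 2]

/-- The two-point hypercontractive inequality for two vectors of a Hilbert space, with squared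
norms `X`, `Y` and inner product `Z`. -/
theorem add_mul_rpow_le_of_sq_le_mul {p : ℝ} (hp1 : 1 < p) (hp2 : p < 2) {X Y Z : ℝ}
    (hX : 0 ≤ X) (hY : 0 ≤ Y) (hZ : Z ^ 2 ≤ X * Y) :
    (X + (p - 1) * Y) ^ (p / 2)
      ≤ ((X + 2 * Z + Y) ^ (p / 2) + (X - 2 * Z + Y) ^ (p / 2)) / 2 := by
  have base := sq_add_mul_sq_rpow_le hp1 hp2 (Real.sqrt_nonneg X) (Real.sqrt_nonneg Y)
  rw [Real.sq_sqrt hX, Real.sq_sqrt hY] at base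
  refine base.trans ?_
  set W := √X * √Y with hW
  have hW0 : 0 ≤ W := by positivity
  have hWsq : W ^ 2 = X * Y := by rw [hW, mul_pow, Real.sq_sqrt hX, Real.sq_sqrt hY]
  have hpow : ∀ t : ℝ, |t| ^ p = (t ^ 2) ^ (p / 2) := fun t => by
    rw [← sq_abs, ← Real.rpow_natCast, ← Real.rpow_mul (abs_nonneg t)]; congr 1; push_cast; ring
  have e1 : (√X + √Y) ^ p = (X + Y + 2 * W) ^ (p / 2) := by
    rw [← abs_of_nonneg (add_nonneg (Real.sqrt_nonneg X) (Real.sqrt_nonneg Y)), hpow]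
    congr 1
    rw [add_sq, Real.sq_sqrt hX, Real.sq_sqrt hY, hW]; ring
  have e2 : |√X - √Y| ^ p = (X + Y - 2 * W) ^ (p / 2) := by
    rw [hpow]
    congr 1
    rw [sub_sq, Real.sq_sqrt hX, Real.sq_sqrt hY, hW]; ring
  rw [e1, e2]
  have hlow : 0 ≤ X + Y - 2 * W := by
    have := sq_nonneg (√X - √Y)
    rw [sub_sq, Real.sq_sqrt hX, Real.sq_sqrt hY] at this
    linarith
  have hZW := abs_le.1 (abs_le_of_sq_le_sq (hZ.trans_eq hWsq.symm) hW0)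
  rcases hW0.eq_or_lt with h0 | hWpos
  · obtain rfl : Z = 0 := by linarith [hZW.1, hZW.2]
    rw [← h0]
    simp
  have conc := Real.concaveOn_rpow (p := p / 2) (by linarith) (by linarith)
  set s := (1 + Z / W) / 2 with hs
  have hZWdiv : Z / W ≤ 1 ∧ -1 ≤ Z / W := by
    rw [div_le_one hWpos, le_div_iff₀ hWpos]
    constructor <;> linarith [hZW.1, hZW.2]
  have hs0 : 0 ≤ s := by rw [hs]; linarith [hZWdiv.2]
  have hs1 : 0 ≤ 1 - s := by rw [hs]; linarith [hZWdiv.1]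
  have hmemP : X + Y + 2 * W ∈ Set.Ici (0 : ℝ) := by
    simp only [Set.mem_Ici]; positivity
  have c1 := conc.2 hmemP hlow hs0 hs1 (by ring)
  have c2 := conc.2 hmemP hlow hs1 hs0 (by ring)
  simp only [smul_eq_mul] at c1 c2
  have hsW : 2 * s * W = W + Z := by rw [hs]; field_simp
  have f1 : s * (X + Y + 2 * W) + (1 - s) * (X + Y - 2 * W) = X + 2 * Z + Y := by
    linear_combination 2 * hsW
  have f2 : (1 - s) * (X + Y + 2 * W) + s * (X + Y - 2 * W) = X - 2 * Z + Y := by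
    linear_combination -2 * hsW
  rw [f1] at c1
  rw [f2] at c2
  linarith

/-- The Walsh character `χ_S` on the cube `ι → Bool`. -/
def walsh {ι : Type*} (S : Finset ι) (x : ι → Bool) : ℝ :=
  ∏ j ∈ S, if x j then (1 : ℝ) else -1

theorem walsh_insert {ι : Type*} [DecidableEq ι] {S : Finset ι} {i : ι} (hi : i ∉ S)
    (x : ι → Bool) : walsh (insert i S) x = (if x i then (1 : ℝ) else -1) * walsh S x :=
  prod_insert hi

/-- Bonami's inequality: the noise operator with parameter `√(p - 1)` is a contraction from
`L^p` to `L^2`, for functions depending on the coordinates in `s`. -/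
theorem sum_sq_rpow_le_sum_abs_rpow {ι : Type*} [Fintype ι] [DecidableEq ι] {p : ℝ}
    (hp1 : 1 < p) (hp2 : p < 2) (s : Finset ι) (c : Finset ι → ℝ) :
    2 ^ Fintype.card ι * (∑ T ∈ s.powerset, (p - 1) ^ T.card * c T ^ 2) ^ (p / 2)
      ≤ ∑ x : ι → Bool, |∑ T ∈ s.powerset, c T * walsh T x| ^ p := by
  induction s using Finset.induction_on generalizing c with
  | empty =>
    simp only [powerset_empty, sum_singleton, card_empty, pow_zero, one_mul, walsh, prod_empty,
      mul_one, sum_const, card_univ, nsmul_eq_mul, Fintype.card_fun, Fintype.card_bool]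
    rw [← sq_abs, ← Real.rpow_natCast |c ∅|, ← Real.rpow_mul (abs_nonneg _)]
    push_cast
    rw [mul_div_cancel₀ p two_ne_zero]
  | insert i s hi ih =>
    have hnotMem : ∀ T ∈ s.powerset, i ∉ T := fun T hT h => hi (mem_powerset.1 hT h)
    let g : (ι → Bool) → ℝ := fun x => ∑ T ∈ s.powerset, c T * walsh T x
    let h : (ι → Bool) → ℝ := fun x => ∑ T ∈ s.powerset, c (insert i T) * walsh T x
    let σ : (ι → Bool) → ℝ := fun x => if x i then 1 else -1
    have hrhs : ∀ x, ∑ T ∈ (insert i s).powerset, c T * walsh T x = g x + σ x * h x := by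
      intro x
      rw [sum_powerset_insert hi]
      congr 1
      simp only [h, mul_sum]
      refine sum_congr rfl fun T hT => ?_
      rw [walsh_insert (hnotMem T hT)]
      simp only [σ]
      ring
    let flip : (ι → Bool) → (ι → Bool) := fun x => Function.update x i (!x i)
    have hflip : Function.Involutive flip := fun x => by
      simp [flip]
    have hwflip : ∀ T ∈ s.powerset, ∀ x, walsh T (flip x) = walsh T x := fun T hT x => by
      refine prod_congr rfl fun j hj => ?_
      have : j ≠ i := fun e => hnotMem T hT (e ▸ hj)
      simp [flip, this]
    have hgflip : ∀ x, g (flip x) = g x := fun x =>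
      sum_congr rfl fun T hT => by rw [hwflip T hT]
    have hhflip : ∀ x, h (flip x) = h x := fun x =>
      sum_congr rfl fun T hT => by rw [hwflip T hT]
    have hσflip : ∀ x, σ (flip x) = -σ x := fun x => by
      simp only [σ, flip, Function.update_self]
      cases x i <;> simp
    have hsum : ∑ x, |g x + σ x * h x| ^ p = (∑ x, |g x + h x| ^ p + ∑ x, |g x - h x| ^ p) / 2 := by
      have h1 : ∑ x, |g x + σ x * h x| ^ p = ∑ x, |g x - σ x * h x| ^ p := by
        refine (Equiv.sum_comp hflip.toPerm _).symm.trans (sum_congr rfl fun x _ => ?_)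
        simp only [Function.Involutive.coe_toPerm, hgflip, hhflip, hσflip]
        ring_nf
      have h2 : ∑ x, |g x + σ x * h x| ^ p + ∑ x, |g x - σ x * h x| ^ p
          = ∑ x, |g x + h x| ^ p + ∑ x, |g x - h x| ^ p := by
        rw [← sum_add_distrib, ← sum_add_distrib]
        refine sum_congr rfl fun x _ => ?_
        simp only [σ]
        cases x i
        · simp only [Bool.false_eq_true, if_false, neg_one_mul, sub_neg_eq_add, ← sub_eq_add_neg]
          ring
        · simp
      linarith
    simp only [hrhs]
    rw [hsum]
    have ihp := ih (fun T => c T + c (insert i T))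
    have ihm := ih (fun T => c T - c (insert i T))
    have hgp : ∀ x, ∑ T ∈ s.powerset, (c T + c (insert i T)) * walsh T x = g x + h x := fun x => by
      simp only [g, h, ← sum_add_distrib, add_mul]
    have hgm : ∀ x, ∑ T ∈ s.powerset, (c T - c (insert i T)) * walsh T x = g x - h x := fun x => by
      simp only [g, h, ← sum_sub_distrib, sub_mul]
    simp only [hgp] at ihp
    simp only [hgm] at ihm
    set X := ∑ T ∈ s.powerset, (p - 1) ^ T.card * c T ^ 2 with hX
    set Y := ∑ T ∈ s.powerset, (p - 1) ^ T.card * c (insert i T) ^ 2 with hY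
    set Z := ∑ T ∈ s.powerset, (p - 1) ^ T.card * (c T * c (insert i T)) with hZ
    have hp0 : 0 ≤ p - 1 := by linarith
    have hsplit : ∑ T ∈ (insert i s).powerset, (p - 1) ^ T.card * c T ^ 2 = X + (p - 1) * Y := by
      rw [sum_powerset_insert hi, hX, hY, mul_sum]
      congr 1
      refine sum_congr rfl fun T hT => ?_
      rw [card_insert_of_notMem (hnotMem T hT)]
      ring
    have hplus : ∑ T ∈ s.powerset, (p - 1) ^ T.card * (c T + c (insert i T)) ^ 2
        = X + 2 * Z + Y := by
      rw [hX, hY, hZ, mul_sum, ← sum_add_distrib, ← sum_add_distrib]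
      exact sum_congr rfl fun T _ => by ring
    have hminus : ∑ T ∈ s.powerset, (p - 1) ^ T.card * (c T - c (insert i T)) ^ 2
        = X - 2 * Z + Y := by
      rw [hX, hY, hZ, mul_sum, ← sum_sub_distrib, ← sum_add_distrib]
      exact sum_congr rfl fun T _ => by ring
    have hCS : Z ^ 2 ≤ X * Y := by
      refine sum_sq_le_sum_mul_sum_of_sq_le_mul _ (fun T _ => by positivity)
        (fun T _ => by positivity) fun T _ => le_of_eq (by ring)
    rw [hplus] at ihp
    rw [hminus] at ihm
    rw [hsplit]
    have two := add_mul_rpow_le_of_sq_le_mul hp1 hp2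
      (sum_nonneg fun T _ => by positivity : 0 ≤ X) (sum_nonneg fun T _ => by positivity : 0 ≤ Y) hCS
    have := mul_le_mul_of_nonneg_left two (by positivity : (0 : ℝ) ≤ 2 ^ Fintype.card ι)
    linarith

open Polynomial in
/-- The coefficients of a polynomial are bounded by its supremum on the unit circle. -/
theorem Polynomial.norm_coeff_le_of_forall_norm_eval_le (P : ℂ[X]) {C : ℝ}
    (h : ∀ z : ℂ, ‖z‖ = 1 → ‖P.eval z‖ ≤ C) (k : ℕ) : ‖P.coeff k‖ ≤ C := by
  have hC : 0 ≤ C := (norm_nonneg _).trans (h 1 norm_one)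
  refine abs_le_of_sq_le_sq' ?_ hC |>.2
  by_cases hk : k ∈ P.support
  · refine (single_le_sum (f := fun i => ‖P.coeff i‖ ^ 2) (fun i _ => sq_nonneg _) hk).trans ?_
    rw [P.sum_sq_norm_coeff_eq_circleAverage]
    refine Real.circleAverage_mono_on_of_le_circle ?_ fun z hz => ?_
    · exact ContinuousOn.circleIntegrable' (by fun_prop)
    · exact pow_le_pow_left₀ (norm_nonneg _) (h z (by simpa using hz)) 2
  · rw [notMem_support_iff.1 hk]
    simpa using sq_nonneg C

theorem Complex.exists_sq_add_one_eq_two_mul (z : ℂ) :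
    ∃ w : ℂ, ‖w‖ ≤ 1 ∧ w ^ 2 + 1 = 2 * z * w := by
  obtain ⟨s, hs⟩ := IsAlgClosed.exists_pow_nat_eq (z ^ 2 - 1) (n := 2) two_pos
  have hprod : (z + s) * (z - s) = 1 := by linear_combination -hs
  rcases le_total ‖z + s‖ 1 with h | h
  · exact ⟨z + s, h, by linear_combination hs⟩
  · refine ⟨z - s, ?_, by linear_combination hs⟩
    have hn : ‖z + s‖ * ‖z - s‖ = 1 := by rw [← norm_mul, hprod, norm_one]
    nlinarith [norm_nonneg (z - s)]

/-- A Bernstein–Walsh type bound: a real polynomial of degree at most `d` bounded by `M` on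
`[-1, 1]` is bounded by `(1 + √2) ^ d * M` on the complex unit circle. -/
theorem norm_sum_mul_pow_le_of_abs_le (d : ℕ) (e : ℕ → ℝ) {M : ℝ}
    (h : ∀ t : ℝ, |t| ≤ 1 → |∑ j ∈ range (d + 1), e j * t ^ j| ≤ M) (z : ℂ) (hz : ‖z‖ = 1) :
    ‖∑ j ∈ range (d + 1), (e j : ℂ) * z ^ j‖ ≤ (1 + √2) ^ d * M := by
  let F : ℂ → ℂ := fun w => ∑ j ∈ range (d + 1), (e j : ℂ) * (((w ^ 2 + 1) / 2) ^ j * w ^ (d - j))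
  have hfactor : ∀ w u : ℂ, w ^ 2 + 1 = 2 * u * w →
      F w = w ^ d * ∑ j ∈ range (d + 1), (e j : ℂ) * u ^ j := by
    intro w u hwu
    simp only [F, mul_sum]
    refine sum_congr rfl fun j hj => ?_
    have hj' : j ≤ d := by simpa [Nat.lt_succ_iff] using hj
    rw [show (w ^ 2 + 1) / 2 = u * w by rw [hwu]; ring, ← Nat.add_sub_of_le hj', pow_add,
      Nat.add_sub_of_le hj', mul_pow]
    ring
  have hcircle : ∀ w : ℂ, ‖w‖ = 1 → ‖F w‖ ≤ M := by
    intro w hw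
    have h1 : w ^ 2 + 1 = 2 * (w.re : ℂ) * w := by
      have h2 : w * (starRingEnd ℂ) w = 1 := by
        rw [Complex.mul_conj, Complex.normSq_eq_norm_sq, hw]; norm_num
      have h3 := Complex.add_conj w
      push_cast at h3
      linear_combination w * h3 - h2
    rw [hfactor w w.re h1, norm_mul, norm_pow, hw, one_pow, one_mul]
    have := h w.re (hw ▸ Complex.abs_re_le_norm w)
    rw [← Real.norm_eq_abs, ← Complex.norm_real] at this
    push_cast at this
    exact this
  have hdisc : ∀ w : ℂ, ‖w‖ ≤ 1 → ‖F w‖ ≤ M := by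
    intro w hw
    refine Complex.norm_le_of_forall_mem_frontier_norm_le (U := Metric.ball (0 : ℂ) 1)
      Metric.isBounded_ball (Differentiable.diffContOnCl (by fun_prop)) (fun v hv => ?_) ?_
    · rw [frontier_ball _ one_ne_zero] at hv
      exact hcircle v (by simpa using hv)
    · rw [closure_ball _ one_ne_zero]
      simpa using hw
  obtain ⟨w, hw1, hwz⟩ := Complex.exists_sq_add_one_eq_two_mul z
  have hlow : 1 ≤ ‖w‖ * (1 + √2) := by
    have h1 : 1 ≤ 2 * ‖w‖ + ‖w‖ ^ 2 := by
      have e1 : (1 : ℂ) = 2 * z * w - w ^ 2 := by linear_combination hwz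
      have e2 := norm_sub_le (2 * z * w) (w ^ 2)
      rw [← e1, norm_mul, norm_mul, hz, norm_pow] at e2
      simpa using e2
    have hs : √2 ^ 2 = 2 := Real.sq_sqrt zero_le_two
    have hs0 : 0 ≤ √2 := Real.sqrt_nonneg 2
    have h2 : √2 ≤ ‖w‖ + 1 := by
      apply Real.sqrt_le_iff.2
      constructor
      · positivity
      · nlinarith
    nlinarith
  have hF := hdisc w hw1
  rw [hfactor w z hwz, norm_mul, norm_pow] at hF
  set R := ‖∑ j ∈ range (d + 1), (e j : ℂ) * z ^ j‖ with hR
  calc R ≤ R * (‖w‖ * (1 + √2)) ^ d :=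
        le_mul_of_one_le_right (norm_nonneg _) (one_le_pow₀ hlow)
    _ = (1 + √2) ^ d * (‖w‖ ^ d * R) := by rw [mul_pow]; ring
    _ ≤ _ := mul_le_mul_of_nonneg_left hF (by positivity)

theorem abs_coeff_le_of_abs_sum_mul_pow_le (d : ℕ) (e : ℕ → ℝ) {M : ℝ}
    (h : ∀ t : ℝ, |t| ≤ 1 → |∑ j ∈ range (d + 1), e j * t ^ j| ≤ M) {k : ℕ} (hk : k ≤ d) :
    |e k| ≤ (1 + √2) ^ d * M := by
  let P : Polynomial ℂ := ∑ j ∈ range (d + 1), Polynomial.monomial j (e j : ℂ)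
  have hP : P.coeff k = e k := by
    simp [P, Polynomial.coeff_monomial, hk]
  have := P.norm_coeff_le_of_forall_norm_eval_le (C := (1 + √2) ^ d * M) (fun z hz => by
    simpa [P, Polynomial.eval_finsetSum, Polynomial.eval_monomial]
      using norm_sum_mul_pow_le_of_abs_le d e h z hz) k
  rwa [hP, Complex.norm_real, Real.norm_eq_abs] at this

theorem sum_prod_apply_bool {ι : Type*} [Fintype ι] [DecidableEq ι] (F : ι → Bool → ℝ) :
    ∑ x : ι → Bool, ∏ j, F j (x j) = ∏ j, (F j true + F j false) := by
  have := prod_univ_sum (fun _ : ι => (univ : Finset Bool)) F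
  rw [Fintype.piFinset_univ] at this
  rw [← this]
  simp

/-- The multilinear extension of a function on the cube `{-1, 1}^ι` attains its maximum modulus
over `[-1, 1]^ι` on the cube. -/
theorem abs_sum_mul_prod_le {ι : Type*} [Fintype ι] [DecidableEq ι] (c : Finset ι → ℝ) {M : ℝ}
    (hM : ∀ x : ι → Bool, |∑ S, c S * walsh S x| ≤ M) (z : ι → ℝ) (hz : ∀ j, |z j| ≤ 1) :
    |∑ S, c S * ∏ j ∈ S, z j| ≤ M := by
  let W : ι → Bool → ℝ := fun j b => if b then (1 + z j) / 2 else (1 - z j) / 2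
  have hW0 : ∀ j b, 0 ≤ W j b := fun j b => by
    have := abs_le.1 (hz j)
    cases b <;> simp [W] <;> linarith
  have hsum1 : ∑ x : ι → Bool, ∏ j, W j (x j) = 1 := by
    rw [sum_prod_apply_bool]
    refine prod_eq_one fun j _ => ?_
    simp [W]
    ring
  have hsumS : ∀ S : Finset ι, ∑ x : ι → Bool, (∏ j, W j (x j)) * walsh S x = ∏ j ∈ S, z j := by
    intro S
    have h1 : ∀ x : ι → Bool, (∏ j, W j (x j)) * walsh S x
        = ∏ j, W j (x j) * (if j ∈ S then (if x j then 1 else -1) else 1) := fun x => by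
      rw [prod_mul_distrib, walsh, prod_ite_mem, univ_inter]
    simp_rw [h1]
    rw [sum_prod_apply_bool (fun j b => W j b * (if j ∈ S then (if b then 1 else -1) else 1)),
      ← univ_inter S, ← prod_ite_mem]
    refine prod_congr rfl fun j _ => ?_
    by_cases hj : j ∈ S <;> simp [W, hj] <;> ring
  have hrep : ∑ S, c S * ∏ j ∈ S, z j
      = ∑ x : ι → Bool, (∏ j, W j (x j)) * ∑ S, c S * walsh S x := by
    simp_rw [← hsumS, mul_sum]
    rw [sum_comm]
    exact sum_congr rfl fun x _ => sum_congr rfl fun S _ => by ring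
  rw [hrep]
  calc _ ≤ ∑ x : ι → Bool, |(∏ j, W j (x j)) * ∑ S, c S * walsh S x| := abs_sum_le_sum_abs _ _
    _ ≤ ∑ x : ι → Bool, (∏ j, W j (x j)) * M := sum_le_sum fun x _ => by
        have := prod_nonneg fun j (_ : j ∈ univ) => hW0 j (x j)
        rw [abs_mul, abs_of_nonneg this]
        exact mul_le_mul_of_nonneg_left (hM x) this
    _ = M := by rw [← sum_mul, hsum1, one_mul]

theorem sum_sum_powerset_sdiff {ι : Type*} [Fintype ι] [DecidableEq ι]
    (F : Finset ι → Finset ι → ℝ) :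
    ∑ U, ∑ S ∈ U.powerset, F S (U \ S) = ∑ S, ∑ T ∈ Sᶜ.powerset, F S T := by
  rw [Finset.sum_sigma', Finset.sum_sigma']
  refine Finset.sum_bij' (fun x _ => ⟨x.2, x.1 \ x.2⟩) (fun x _ => ⟨x.1 ∪ x.2, x.1⟩)
    ?_ ?_ ?_ ?_ ?_
  · rintro ⟨U, S⟩ h
    simp only [mem_sigma, mem_univ, mem_powerset, true_and] at h ⊢
    intro j hj
    exact mem_compl.2 (mem_sdiff.1 hj).2
  · rintro ⟨S, T⟩ h
    exact mem_sigma.2 ⟨mem_univ _, mem_powerset.2 subset_union_left⟩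
  · rintro ⟨U, S⟩ h
    simp only [mem_sigma, mem_univ, mem_powerset, true_and] at h ⊢
    simp [union_sdiff_of_subset h]
  · rintro ⟨S, T⟩ h
    simp only [mem_sigma, mem_univ, mem_powerset, true_and] at h ⊢
    have : Disjoint T S := by
      rw [disjoint_left]
      exact fun j hj => mem_compl.1 (h hj)
    simp [union_sdiff_cancel_left this.symm]
  · rintro ⟨U, S⟩ h
    rfl

/-- Polarisation: the part of degree `k` in `x` of the decoupled form of a homogeneous function
of degree `d` on the cube. -/
theorem abs_sum_walsh_mul_walsh_le {ι : Type*} [Fintype ι] [DecidableEq ι] {k d : ℕ} (hk : 0 < k)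
    (hkd : k < d) (c : Finset ι → ℝ) (hc : ∀ U, U.card ≠ d → c U = 0) {M : ℝ}
    (hM : ∀ x : ι → Bool, |∑ S, c S * walsh S x| ≤ M) (x y : ι → Bool) :
    |∑ S ∈ powersetCard k univ, (∑ T ∈ Sᶜ.powerset, c (S ∪ T) * walsh T y) * walsh S x|
      ≤ (1 + √2) ^ d * (d : ℝ) ^ d / ((k : ℝ) ^ k * ((d - k : ℕ) : ℝ) ^ (d - k)) * M := by
  have hk0 : (0 : ℝ) < k := by exact_mod_cast hk
  have hl0 : (0 : ℝ) < ((d - k : ℕ) : ℝ) := by exact_mod_cast (by omega : 0 < d - k)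
  have hd0 : (0 : ℝ) < d := by exact_mod_cast (by omega : 0 < d)
  have hd : ((d - k : ℕ) : ℝ) = d - k := Nat.cast_sub hkd.le
  set α : ℝ := k / d with hα
  set β : ℝ := ((d - k : ℕ) : ℝ) / d with hβ
  have hαβ : α + β = 1 := by rw [hα, hβ, hd]; field_simp; ring
  have hα0 : 0 < α := by positivity
  have hβ0 : 0 < β := by positivity
  let σ : (ι → Bool) → ι → ℝ := fun x j => if x j then 1 else -1
  have hσ : ∀ x j, |σ x j| = 1 := fun x j => by
    simp only [σ]; cases x j <;> simp
  let G : Finset ι → ℝ := fun S => ∑ T ∈ Sᶜ.powerset, c (S ∪ T) * walsh T y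
  let e : ℕ → ℝ := fun j =>
    α ^ j * β ^ (d - j) * ∑ S ∈ powersetCard j univ, G S * walsh S x
  have hexp : ∀ t : ℝ, ∑ U, c U * ∏ j ∈ U, (α * t * σ x j + β * σ y j)
      = ∑ j ∈ range (d + 1), e j * t ^ j := by
    intro t
    let Φ : Finset ι → Finset ι → ℝ := fun S T =>
      c (S ∪ T) * ((α * t) ^ S.card * walsh S x * (β ^ (d - S.card) * walsh T y))
    have h1 : ∀ U, c U * ∏ j ∈ U, (α * t * σ x j + β * σ y j)
        = ∑ S ∈ U.powerset, Φ S (U \ S) := by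
      intro U
      rw [prod_add, mul_sum]
      refine sum_congr rfl fun S hS => ?_
      have hSU := mem_powerset.1 hS
      simp only [Φ, prod_mul_distrib, prod_const, union_sdiff_of_subset hSU]
      by_cases hcard : U.card = d
      · rw [card_sdiff_of_subset hSU, hcard, mul_pow]
        rfl
      · simp [hc U hcard]
    have h2 : ∀ S : Finset ι, ∑ T ∈ Sᶜ.powerset, Φ S T
        = α ^ S.card * β ^ (d - S.card) * (G S * walsh S x) * t ^ S.card := by
      intro S
      simp only [G, Φ, sum_mul, mul_sum]
      exact sum_congr rfl fun T _ => by rw [mul_pow]; ring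
    rw [sum_congr rfl fun U _ => h1 U, sum_sum_powerset_sdiff, sum_congr rfl fun S _ => h2 S]
    have h3 : ∀ S ∈ (univ : Finset (Finset ι)), S.card ∉ range (d + 1) →
        α ^ S.card * β ^ (d - S.card) * (G S * walsh S x) * t ^ S.card = 0 := by
      intro S _ hS
      have hG : G S = 0 := by
        refine sum_eq_zero fun T _ => ?_
        rw [hc, zero_mul]
        have := card_le_card (subset_union_left : S ⊆ S ∪ T)
        simp only [mem_range, not_lt] at hS
        omega
      simp [hG]
    rw [← sum_filter_of_ne (p := fun S => S.card ∈ range (d + 1)) fun S hS hne => by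
        by_contra hcon; exact hne (h3 S hS hcon),
      ← sum_fiberwise_of_maps_to (t := range (d + 1)) (g := Finset.card)
        fun S hS => (mem_filter.1 hS).2]
    refine sum_congr rfl fun j hj => ?_
    have : ((univ.filter fun S : Finset ι => S.card ∈ range (d + 1)).filter fun S => S.card = j)
        = powersetCard j univ := by
      ext S
      simp only [mem_filter, mem_univ, true_and, mem_powersetCard_univ]
      exact ⟨fun h => h.2, fun h => ⟨h ▸ hj, h⟩⟩
    rw [this]
    simp only [e, mul_sum, sum_mul]
    refine sum_congr rfl fun S hS => ?_
    rw [(mem_powersetCard.1 hS).2]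
  have hbound := abs_coeff_le_of_abs_sum_mul_pow_le d e (M := M) (fun t ht => by
    rw [← hexp t]
    refine abs_sum_mul_prod_le c hM _ fun j => ?_
    calc |α * t * σ x j + β * σ y j| ≤ |α * t * σ x j| + |β * σ y j| := abs_add_le _ _
      _ = α * |t| + β := by
        rw [abs_mul, abs_mul, abs_mul, hσ, hσ, abs_of_pos hα0, abs_of_pos hβ0]; ring
      _ ≤ 1 := by nlinarith) hkd.le
  simp only [e] at hbound
  rw [abs_mul, abs_of_pos (by positivity)] at hbound
  have hprod : α ^ k * β ^ (d - k)
      = (k : ℝ) ^ k * ((d - k : ℕ) : ℝ) ^ (d - k) / (d : ℝ) ^ d := by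
    rw [hα, hβ, div_pow, div_pow, div_mul_div_comm, ← pow_add, Nat.add_sub_of_le hkd.le]
  rw [hprod] at hbound
  rw [div_mul_eq_mul_div, le_div_iff₀ (by positivity)]
  rw [div_mul_eq_mul_div, div_le_iff₀ (by positivity)] at hbound
  linarith

theorem sum_powersetCard_succ_erase {ι : Type*} [Fintype ι] [DecidableEq ι] (m : ℕ)
    (F : Finset ι → ι → ℝ) :
    ∑ S ∈ powersetCard (m + 1) univ, ∑ j ∈ S, F (S.erase j) j
      = ∑ R ∈ powersetCard m univ, ∑ j ∈ Rᶜ, F R j := by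
  rw [Finset.sum_sigma', Finset.sum_sigma']
  refine Finset.sum_bij' (fun x _ => ⟨x.1.erase x.2, x.2⟩) (fun x _ => ⟨insert x.2 x.1, x.2⟩)
    ?_ ?_ ?_ ?_ ?_
  · rintro ⟨S, j⟩ h
    simp only [mem_sigma, mem_powersetCard_univ, mem_compl] at h ⊢
    simp [card_erase_of_mem h.2, h.1]
  · rintro ⟨S, j⟩ h
    simp only [mem_sigma, mem_powersetCard_univ, mem_compl] at h ⊢
    simp [card_insert_of_notMem h.2, h.1]
  · rintro ⟨S, j⟩ h
    simp only [mem_sigma, mem_powersetCard_univ] at h ⊢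
    simp [insert_erase h.2]
  · rintro ⟨S, j⟩ h
    simp only [mem_sigma, mem_powersetCard_univ, mem_compl] at h ⊢
    simp [erase_insert h.2]
  · rintro ⟨S, j⟩ h
    rfl

theorem sum_insert_eq_mul_sum_powersetCard_succ {ι : Type*} [Fintype ι] [DecidableEq ι] (m : ℕ)
    (G : Finset ι → ℝ) :
    ∑ R ∈ powersetCard m univ, ∑ j ∈ Rᶜ, G (insert j R)
      = (m + 1) * ∑ S ∈ powersetCard (m + 1) univ, G S := by
  rw [← sum_powersetCard_succ_erase m (fun R j => G (insert j R)), mul_sum]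
  refine sum_congr rfl fun S hS => ?_
  rw [sum_congr rfl fun j hj => by rw [insert_erase hj], sum_const, (mem_powersetCard.1 hS).2,
    nsmul_eq_mul]
  push_cast
  rfl

theorem mul_sum_prod_erase {ι : Type*} [Fintype ι] [DecidableEq ι] (m : ℕ)
    (h : Finset ι → ℝ) :
    (m + 1) * ∑ S ∈ powersetCard (m + 1) univ, ∏ j ∈ S, h (S.erase j)
      = ∑ R ∈ powersetCard m univ, h R * ∑ t ∈ Rᶜ, ∏ j ∈ R, h (insert t (R.erase j)) := by
  simp_rw [mul_sum (s := _ᶜ)]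
  rw [← sum_powersetCard_succ_erase m
    (fun R t => h R * ∏ j ∈ R, h (insert t (R.erase j))), mul_sum]
  refine sum_congr rfl fun S hS => ?_
  have : ∀ t ∈ S, h (S.erase t) * ∏ j ∈ S.erase t, h (insert t ((S.erase t).erase j))
      = ∏ j ∈ S, h (S.erase j) := by
    intro t ht
    rw [← mul_prod_erase S _ ht]
    congr 1
    refine prod_congr rfl fun j hj => ?_
    rw [erase_right_comm, insert_erase]
    exact mem_erase.2 ⟨(ne_of_mem_erase hj).symm, ht⟩
  rw [sum_congr rfl this, sum_const, (mem_powersetCard.1 hS).2, nsmul_eq_mul]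
  push_cast
  rfl

/-- A symmetric Loomis–Whitney inequality for functions on finite sets. -/
theorem sum_prod_erase_le {ι : Type*} [Fintype ι] [DecidableEq ι] (m : ℕ) (hm : 1 ≤ m)
    (h : Finset ι → ℝ) (h0 : ∀ S, 0 ≤ h S) :
    ∑ S ∈ powersetCard (m + 1) univ, ∏ j ∈ S, h (S.erase j)
      ≤ (∑ R ∈ powersetCard m univ, h R ^ m) ^ (((m : ℝ) + 1) / m) := by
  induction m, hm using Nat.le_induction generalizing h with
  | base =>
    have key := mul_sum_prod_erase 1 h
    have hle : ∑ R ∈ powersetCard 1 univ, h R * ∑ t ∈ Rᶜ, ∏ j ∈ R, h (insert t (R.erase j))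
        ≤ ∑ R ∈ powersetCard 1 univ, h R * ∑ T ∈ powersetCard 1 univ, h T := by
      refine sum_le_sum fun R hR => mul_le_mul_of_nonneg_left ?_ (h0 R)
      obtain ⟨r, rfl⟩ := card_eq_one.1 (mem_powersetCard.1 hR).2
      simp only [prod_singleton, erase_singleton, powersetCard_one, sum_map]
      exact sum_le_univ_sum_of_nonneg fun t => h0 _
    rw [← sum_mul] at hle
    have hpos : 0 ≤ ∑ S ∈ powersetCard (1 + 1) univ, ∏ j ∈ S, h (S.erase j) :=
      sum_nonneg fun S _ => prod_nonneg fun j _ => h0 _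
    have : (((1 : ℕ) : ℝ) + 1) / ((1 : ℕ) : ℝ) = 2 := by norm_num
    rw [this]
    simp only [pow_one, Real.rpow_two]
    push_cast at key
    nlinarith
  | succ m hm ih =>
    have hm0 : (0 : ℝ) < m := by exact_mod_cast hm
    set H := ∑ R ∈ powersetCard (m + 1) univ, h R ^ (m + 1) with hH
    have hH0 : 0 ≤ H := sum_nonneg fun R _ => pow_nonneg (h0 R) _
    let g : ι → Finset ι → ℝ := fun t R => if t ∈ R then 0 else h (insert t R)
    have hg0 : ∀ t R, 0 ≤ g t R := fun t R => by
      simp only [g]; split_ifs <;> simp [h0]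
    have key := mul_sum_prod_erase (m + 1) h
    have h1 : ∑ R ∈ powersetCard (m + 1) univ, h R * ∑ t ∈ Rᶜ, ∏ j ∈ R, h (insert t (R.erase j))
        ≤ ∑ t, ∑ R ∈ powersetCard (m + 1) univ, h R * ∏ j ∈ R, g t (R.erase j) := by
      rw [sum_comm]
      refine sum_le_sum fun R _ => ?_
      rw [← mul_sum]
      refine mul_le_mul_of_nonneg_left ?_ (h0 R)
      calc ∑ t ∈ Rᶜ, ∏ j ∈ R, h (insert t (R.erase j))
          = ∑ t ∈ Rᶜ, ∏ j ∈ R, g t (R.erase j) := by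
            refine sum_congr rfl fun t ht => prod_congr rfl fun j _ => ?_
            have : t ∉ R.erase j := fun h' => (mem_compl.1 ht) (mem_of_mem_erase h')
            simp only [g, if_neg this]
        _ ≤ _ := sum_le_univ_sum_of_nonneg fun t => prod_nonneg fun j _ => hg0 _ _
    have h2 : ∀ t, ∑ R ∈ powersetCard (m + 1) univ, h R * ∏ j ∈ R, g t (R.erase j)
        ≤ H ^ (1 / ((m : ℝ) + 1)) * ∑ R ∈ powersetCard m univ, g t R ^ (m + 1) := by
      intro t
      have hpq : ((m : ℝ) + 1).HolderConjugate (((m : ℝ) + 1) / m) := by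
        rw [Real.holderConjugate_iff]
        constructor
        · linarith
        · field_simp; ring
      have hold := Real.inner_le_Lp_mul_Lq_of_nonneg (powersetCard (m + 1) univ) hpq
        (f := h) (g := fun R => ∏ j ∈ R, g t (R.erase j)) (fun R _ => h0 R)
        (fun R _ => prod_nonneg fun j _ => hg0 _ _)
      have e1 : ∑ R ∈ powersetCard (m + 1) univ, h R ^ ((m : ℝ) + 1) = H := by
        refine sum_congr rfl fun R _ => ?_
        rw [← Real.rpow_natCast]; push_cast; rfl
      have e2 : ∑ R ∈ powersetCard (m + 1) univ,
          (∏ j ∈ R, g t (R.erase j)) ^ (((m : ℝ) + 1) / m)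
          ≤ (∑ R ∈ powersetCard m univ, g t R ^ (m + 1)) ^ (((m : ℝ) + 1) / m) := by
        have := ih (fun R => g t R ^ (((m : ℝ) + 1) / m)) (fun R => Real.rpow_nonneg (hg0 t R) _)
        simp only [Real.finsetProd_rpow _ _ (fun j _ => hg0 t _)] at this
        refine this.trans_eq ?_
        congr 1
        refine sum_congr rfl fun R _ => ?_
        rw [← Real.rpow_natCast, ← Real.rpow_mul (hg0 t R), ← Real.rpow_natCast]
        congr 1
        push_cast
        field_simp
      rw [e1] at hold
      refine hold.trans ?_
      refine mul_le_mul_of_nonneg_left ?_ (Real.rpow_nonneg hH0 _)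
      have hnn : 0 ≤ ∑ R ∈ powersetCard m univ, g t R ^ (m + 1) :=
        sum_nonneg fun R _ => pow_nonneg (hg0 t R) _
      calc _ ≤ ((∑ R ∈ powersetCard m univ, g t R ^ (m + 1)) ^ (((m : ℝ) + 1) / m))
                ^ (1 / (((m : ℝ) + 1) / m)) :=
            Real.rpow_le_rpow (sum_nonneg fun R _ => Real.rpow_nonneg
              (prod_nonneg fun j _ => hg0 _ _) _) e2 (by positivity)
        _ = _ := by
            rw [← Real.rpow_mul hnn, mul_one_div_cancel (by positivity), Real.rpow_one]
    have h3 : ∑ t, ∑ R ∈ powersetCard m univ, g t R ^ (m + 1) = (m + 1) * H := by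
      rw [hH, ← sum_insert_eq_mul_sum_powersetCard_succ m (fun R => h R ^ (m + 1)), sum_comm]
      refine sum_congr rfl fun R _ => ?_
      rw [← sum_subset (subset_univ Rᶜ)]
      · refine sum_congr rfl fun t ht => ?_
        simp only [g, if_neg (mem_compl.1 ht)]
      · intro t _ ht
        rw [mem_compl, not_not] at ht
        simp [g, ht]
    have h4 := (h1.trans (sum_le_sum fun t _ => h2 t)).trans_eq (mul_sum _ _ _).symm
    rw [h3] at h4
    have h5 : H ^ ((((m + 1 : ℕ) : ℝ) + 1) / ((m + 1 : ℕ) : ℝ)) = H ^ (1 / ((m : ℝ) + 1)) * H := by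
      conv_rhs => rw [← Real.rpow_one H, ← Real.rpow_mul hH0, one_mul]
      rw [← Real.rpow_add' hH0 (by positivity)]
      congr 1
      push_cast
      field_simp
      ring
    rw [h5]
    push_cast at key
    have hX : 0 ≤ H ^ (1 / ((m : ℝ) + 1)) * H := mul_nonneg (Real.rpow_nonneg hH0 _) hH0
    have : ((m : ℝ) + 1 + 1) * ∑ S ∈ powersetCard (m + 1 + 1) univ, ∏ j ∈ S, h (S.erase j)
        ≤ ((m : ℝ) + 1 + 1) * (H ^ (1 / ((m : ℝ) + 1)) * H) := by
      nlinarith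
    exact le_of_mul_le_mul_left this (by positivity)

/-- One step of Blei's inequality, from functions on `m`-sets to functions on `(m + 1)`-sets. -/
theorem sum_rpow_le_of_sum_insert_sq {ι : Type*} [Fintype ι] [DecidableEq ι] (m : ℕ) (hm : 1 ≤ m)
    (a b : Finset ι → ℝ) (ha : ∀ S, 0 ≤ a S) (hb : ∀ S, 0 ≤ b S) (D : ℝ) (hD : 0 ≤ D)
    (hab : ∀ R ∈ powersetCard m univ, ∑ j ∈ Rᶜ, a (insert j R) ^ 2 = D * b R ^ 2) :
    ∑ S ∈ powersetCard (m + 1) univ, a S ^ (2 * ((m : ℝ) + 1) / ((m : ℝ) + 2))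
      ≤ (D / ((m : ℝ) + 1)) ^ (((m : ℝ) + 1) / ((m : ℝ) + 2))
        * (∑ R ∈ powersetCard m univ, b R ^ (2 * (m : ℝ) / ((m : ℝ) + 1)))
          ^ (((m : ℝ) + 1) ^ 2 / (((m : ℝ) + 2) * m)) := by
  have hm0 : (0 : ℝ) < m := by exact_mod_cast hm
  set M : ℝ := (m : ℝ) + 1 with hM
  have hM0 : 0 < M := by positivity
  have hM2 : (m : ℝ) + 2 = M + 1 := by rw [hM]; ring
  rw [hM2]
  have hM10 : 0 < M + 1 := by positivity
  let X : Finset ι → ℝ := fun S => a S ^ 2 * (1 / M * ∑ j ∈ S, b (S.erase j) ^ (-(2 / M)))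
  let Y : Finset ι → ℝ := fun S => ∏ j ∈ S, b (S.erase j) ^ (2 / M)
  set E := ∑ R ∈ powersetCard m univ, b R ^ (2 * (m : ℝ) / M) with hE
  have hE0 : 0 ≤ E := sum_nonneg fun R _ => Real.rpow_nonneg (hb R) _
  have hX0 : ∀ S, 0 ≤ X S := fun S => mul_nonneg (sq_nonneg _)
    (mul_nonneg (by positivity) (sum_nonneg fun j _ => Real.rpow_nonneg (hb _) _))
  have hY0 : ∀ S, 0 ≤ Y S := fun S => prod_nonneg fun j _ => Real.rpow_nonneg (hb _) _
  have hpt : ∀ S ∈ powersetCard (m + 1) univ,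
      a S ^ (2 * M / (M + 1)) ≤ X S ^ (M / (M + 1)) * Y S ^ (1 / (M + 1)) := by
    intro S hS
    have hScard := (mem_powersetCard.1 hS).2
    rcases (ha S).eq_or_lt with h0 | hpos
    · rw [← h0, Real.zero_rpow (by positivity)]
      exact mul_nonneg (Real.rpow_nonneg (hX0 S) _) (Real.rpow_nonneg (hY0 S) _)
    have hbpos : ∀ j ∈ S, 0 < b (S.erase j) := by
      intro j hj
      refine (hb _).lt_of_ne fun h0 => ?_
      have h1 := hab (S.erase j) (by simp [mem_powersetCard, card_erase_of_mem hj, hScard])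
      rw [← h0] at h1
      have h2 := single_le_sum (s := (S.erase j)ᶜ) (f := fun i => a (insert i (S.erase j)) ^ 2)
        (fun i _ => sq_nonneg _) (show j ∈ (S.erase j)ᶜ by simp)
      rw [h1] at h2
      simp only [insert_erase hj] at h2
      nlinarith
    have hYpos : 0 < Y S := prod_pos fun j hj => Real.rpow_pos_of_pos (hbpos j hj) _
    have amgm : Y S ^ (-(1 / M)) ≤ 1 / M * ∑ j ∈ S, b (S.erase j) ^ (-(2 / M)) := by
      have := Real.geom_mean_le_arith_mean_weighted S (fun _ => 1 / M)
        (fun j => b (S.erase j) ^ (-(2 / M))) (fun _ _ => by positivity)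
        (by rw [sum_const, hScard, nsmul_eq_mul]; push_cast; rw [← hM]; field_simp)
        (fun j _ => Real.rpow_nonneg (hb _) _)
      rw [mul_sum]
      refine le_trans (le_of_eq ?_) this
      rw [← Real.finsetProd_rpow _ _ (fun j _ => Real.rpow_nonneg (hb _) _)]
      refine prod_congr rfl fun j _ => ?_
      rw [← Real.rpow_mul (hb _), ← Real.rpow_mul (hb _)]
      congr 1
      ring
    calc a S ^ (2 * M / (M + 1))
        = (a S ^ 2 * Y S ^ (-(1 / M))) ^ (M / (M + 1)) * Y S ^ (1 / (M + 1)) := by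
          rw [Real.mul_rpow (sq_nonneg _) (Real.rpow_nonneg (hY0 S) _), ← Real.rpow_mul (hY0 S),
            mul_assoc, ← Real.rpow_add hYpos, ← Real.rpow_natCast, ← Real.rpow_mul (ha S)]
          have : -(1 / M) * (M / (M + 1)) + 1 / (M + 1) = 0 := by field_simp; ring
          rw [this, Real.rpow_zero, mul_one]
          congr 1
          push_cast
          ring
      _ ≤ _ := by
          refine mul_le_mul_of_nonneg_right (Real.rpow_le_rpow ?_ ?_ (by positivity))
            (Real.rpow_nonneg (hY0 S) _)
          · exact mul_nonneg (sq_nonneg _) (Real.rpow_nonneg (hY0 S) _)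
          · exact mul_le_mul_of_nonneg_left amgm (sq_nonneg _)
  have hold : ∑ S ∈ powersetCard (m + 1) univ, X S ^ (M / (M + 1)) * Y S ^ (1 / (M + 1))
      ≤ (∑ S ∈ powersetCard (m + 1) univ, X S) ^ (M / (M + 1))
        * (∑ S ∈ powersetCard (m + 1) univ, Y S) ^ (1 / (M + 1)) := by
    have hpq : ((M + 1) / M).HolderConjugate (M + 1) := by
      rw [Real.holderConjugate_iff]
      constructor
      · rw [lt_div_iff₀ hM0]; linarith
      · field_simp
    have := Real.inner_le_Lp_mul_Lq_of_nonneg (powersetCard (m + 1) univ) hpq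
      (f := fun S => X S ^ (M / (M + 1))) (g := fun S => Y S ^ (1 / (M + 1)))
      (fun S _ => Real.rpow_nonneg (hX0 S) _) (fun S _ => Real.rpow_nonneg (hY0 S) _)
    refine this.trans_eq ?_
    have e1 : ∀ S, (X S ^ (M / (M + 1))) ^ ((M + 1) / M) = X S := fun S => by
      rw [← Real.rpow_mul (hX0 S), div_mul_div_cancel₀ hM10.ne', div_self hM0.ne', Real.rpow_one]
    have e2 : ∀ S, (Y S ^ (1 / (M + 1))) ^ (M + 1) = Y S := fun S => by
      rw [← Real.rpow_mul (hY0 S), one_div_mul_cancel hM10.ne', Real.rpow_one]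
    simp only [e1, e2, one_div_div]
  have hXsum : ∑ S ∈ powersetCard (m + 1) univ, X S ≤ D / M * E := by
    have e1 : ∑ S ∈ powersetCard (m + 1) univ, X S
        = ∑ R ∈ powersetCard m univ, ∑ j ∈ Rᶜ, 1 / M * (b R ^ (-(2 / M)) * a (insert j R) ^ 2) := by
      rw [← sum_powersetCard_succ_erase m
        (fun R j => 1 / M * (b R ^ (-(2 / M)) * a (insert j R) ^ 2))]
      refine sum_congr rfl fun S _ => ?_
      simp only [X, mul_sum]
      refine sum_congr rfl fun j hj => ?_
      rw [insert_erase hj]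
      ring
    rw [e1, hE, mul_sum]
    refine sum_le_sum fun R hR => ?_
    rw [← mul_sum, ← mul_sum, hab R hR]
    rcases (hb R).eq_or_lt with h0 | hpos
    · rw [← h0]
      simp only [ne_eq, OfNat.ofNat_ne_zero, not_false_eq_true, zero_pow, mul_zero]
      positivity
    · refine le_of_eq ?_
      have : b R ^ (2 * (m : ℝ) / M) = b R ^ (-(2 / M)) * b R ^ 2 := by
        rw [← Real.rpow_natCast, ← Real.rpow_add hpos]
        congr 1
        push_cast
        field_simp
        rw [hM]
        ring
      rw [this]
      ring
  have hYsum : ∑ S ∈ powersetCard (m + 1) univ, Y S ≤ E ^ (M / m) := by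
    refine (sum_prod_erase_le m hm (fun S => b S ^ (2 / M))
      (fun S => Real.rpow_nonneg (hb S) _)).trans_eq ?_
    rw [← hM, hE]
    congr 1
    refine sum_congr rfl fun R _ => ?_
    rw [← Real.rpow_natCast, ← Real.rpow_mul (hb R)]
    congr 1
    ring
  calc _ ≤ _ := sum_le_sum hpt
    _ ≤ _ := hold
    _ ≤ (D / M * E) ^ (M / (M + 1)) * (E ^ (M / m)) ^ (1 / (M + 1)) :=
        mul_le_mul (Real.rpow_le_rpow (sum_nonneg fun S _ => hX0 S) hXsum (by positivity))
          (Real.rpow_le_rpow (sum_nonneg fun S _ => hY0 S) hYsum (by positivity))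
          (Real.rpow_nonneg (sum_nonneg fun S _ => hY0 S) _)
          (Real.rpow_nonneg (by positivity) _)
    _ = _ := by
        rw [Real.mul_rpow (by positivity) hE0, ← Real.rpow_mul hE0, mul_assoc,
          ← Real.rpow_add' hE0 (by positivity)]
        congr 2
        field_simp
        exact hM.symm

theorem sum_sum_insert_subset {ι : Type*} [Fintype ι] [DecidableEq ι] {d : ℕ} (g : Finset ι → ℝ)
    (hg : ∀ U, U.card ≠ d → g U = 0) (R : Finset ι) :
    ∑ j ∈ Rᶜ, ∑ U with insert j R ⊆ U, g U = ((d : ℝ) - R.card) * ∑ U with R ⊆ U, g U := by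
  have h1 : ∀ j, ∑ U with insert j R ⊆ U, g U
      = ∑ U with R ⊆ U, if j ∈ U then g U else 0 := fun j => by
    rw [← sum_filter, filter_filter]
    congr 1
    ext U
    simp [insert_subset_iff, and_comm]
  simp_rw [h1]
  rw [sum_comm, mul_sum]
  refine sum_congr rfl fun U hU => ?_
  by_cases hc : U.card = d
  · rw [← sum_filter, sum_const, nsmul_eq_mul]
    have hRU : R ⊆ U := (mem_filter.1 hU).2
    have : (Rᶜ.filter fun j => j ∈ U) = U \ R := by ext j; simp [and_comm]
    rw [this, cast_card_sdiff hRU, hc]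
  · simp [hg U hc]

/-- Blei's inequality for functions on the `d`-subsets of a finite set. -/
theorem sum_rpow_le_sum_sqrt_rpow {ι : Type*} [Fintype ι] [DecidableEq ι] {k d : ℕ} (hk : 1 ≤ k)
    (hkd : k ≤ d) (c : Finset ι → ℝ) (hc : ∀ U, U.card ≠ d → c U = 0) :
    (∑ S, |c S| ^ (2 * (d : ℝ) / (d + 1))) ^ (((d : ℝ) + 1) / (2 * d))
      ≤ (∑ S ∈ powersetCard k univ, √(∑ U with S ⊆ U, c U ^ 2) ^ (2 * (k : ℝ) / (k + 1)))
        ^ (((k : ℝ) + 1) / (2 * k)) := by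
  let A : Finset ι → ℝ := fun S => √(∑ U with S ⊆ U, c U ^ 2)
  have hA0 : ∀ S, 0 ≤ A S := fun S => Real.sqrt_nonneg _
  let E : ℕ → ℝ := fun m => ∑ S ∈ powersetCard m univ, A S ^ (2 * (m : ℝ) / (m + 1))
  have hE0 : ∀ m, 0 ≤ E m := fun m => sum_nonneg fun S _ => Real.rpow_nonneg (hA0 S) _
  have hAsq : ∀ S, A S ^ 2 = ∑ U with S ⊆ U, c U ^ 2 := fun S =>
    Real.sq_sqrt (sum_nonneg fun U _ => sq_nonneg _)
  have step : ∀ m, k ≤ m → m ≤ d → E m ^ (((m : ℝ) + 1) / (2 * m)) * √(d.choose k)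
      ≤ √(d.choose m) * E k ^ (((k : ℝ) + 1) / (2 * k)) := by
    intro m hkm
    induction m, hkm using Nat.le_induction with
    | base => intro _; rw [mul_comm]
    | succ m hkm ih =>
      intro hmd
      have ih := ih (by omega)
      have hm : 1 ≤ m := by omega
      have hm0 : (0 : ℝ) < m := by exact_mod_cast hm
      have hmd' : (m : ℝ) + 1 ≤ d := by exact_mod_cast hmd
      have hD : (0 : ℝ) ≤ (d : ℝ) - m := by linarith
      have key := sum_rpow_le_of_sum_insert_sq m hm A A hA0 hA0 ((d : ℝ) - m) hD
        (fun R hR => by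
          simp_rw [hAsq]
          rw [sum_sum_insert_subset (d := d) (fun U => c U ^ 2) (fun U hU => by simp [hc U hU]),
            (mem_powersetCard.1 hR).2])
      have hE1 : E (m + 1) = ∑ S ∈ powersetCard (m + 1) univ,
          A S ^ (2 * ((m : ℝ) + 1) / ((m : ℝ) + 2)) := by
        simp only [E]
        push_cast
        rw [show (m : ℝ) + 1 + 1 = m + 2 by ring]
      rw [← hE1] at key
      have hstep : E (m + 1) ^ ((((m + 1 : ℕ) : ℝ) + 1) / (2 * ((m + 1 : ℕ) : ℝ)))
          ≤ √(((d : ℝ) - m) / (m + 1)) * E m ^ (((m : ℝ) + 1) / (2 * m)) := by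
        refine (Real.rpow_le_rpow (hE0 _) key (by positivity)).trans_eq ?_
        rw [Real.mul_rpow (by positivity) (Real.rpow_nonneg (hE0 m) _),
          ← Real.rpow_mul (by positivity), ← Real.rpow_mul (hE0 m), Real.sqrt_eq_rpow]
        congr 2
        · push_cast; field_simp; ring
        · push_cast; field_simp; ring
      have hch : √(d.choose (m + 1) : ℝ) = √(((d : ℝ) - m) / (m + 1)) * √(d.choose m) := by
        rw [← Real.sqrt_mul (by positivity)]
        congr 1
        have h := Nat.choose_succ_right_eq d m
        have h' : (d.choose (m + 1) : ℝ) * (m + 1) = d.choose m * ((d : ℝ) - m) := by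
          rw [← Nat.cast_sub (by omega)]
          exact_mod_cast h
        field_simp
        linarith
      rw [hch, mul_assoc]
      calc _ ≤ _ := mul_le_mul_of_nonneg_right hstep (Real.sqrt_nonneg _)
        _ = √(((d : ℝ) - m) / (m + 1)) * (E m ^ (((m : ℝ) + 1) / (2 * m)) * √(d.choose k)) := by
          ring
        _ ≤ _ := mul_le_mul_of_nonneg_left ih (Real.sqrt_nonneg _)
  have hfin := step d hkd le_rfl
  rw [Nat.choose_self, Nat.cast_one, Real.sqrt_one, one_mul] at hfin
  have hlhs : ∑ S, |c S| ^ (2 * (d : ℝ) / (d + 1)) = E d := by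
    have hd0 : (0 : ℝ) < d := by exact_mod_cast (by omega : 0 < d)
    simp only [E]
    rw [← sum_subset (subset_univ (powersetCard d univ))]
    · refine sum_congr rfl fun S hS => ?_
      have hS' := (mem_powersetCard.1 hS).2
      congr 1
      rw [← Real.sqrt_sq_eq_abs]
      simp only [A]
      congr 1
      rw [sum_eq_single S]
      · intro U hU hne
        have hSU : S ⊆ U := (mem_filter.1 hU).2
        rw [hc U, sq, zero_mul]
        intro hcard
        exact hne (eq_of_subset_of_card_le hSU (by omega)).symm
      · simp
    · intro S _ hS
      rw [hc S (by simpa [mem_powersetCard] using hS), abs_zero, Real.zero_rpow (by positivity)]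
  rw [hlhs]
  refine le_trans ?_ hfin
  refine le_mul_of_one_le_right (Real.rpow_nonneg (hE0 d) _) ?_
  rw [Real.one_le_sqrt]
  exact_mod_cast Nat.choose_pos hkd

theorem sum_powerset_compl_union {ι : Type*} [Fintype ι] [DecidableEq ι] (S : Finset ι)
    (F : Finset ι → ℝ) :
    ∑ T ∈ Sᶜ.powerset, F (S ∪ T) = ∑ U with S ⊆ U, F U := by
  refine sum_bij' (fun T _ => S ∪ T) (fun U _ => U \ S) ?_ ?_ ?_ ?_ ?_
  · intro T _
    simp
  · intro U _
    rw [mem_powerset]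
    exact fun j hj => mem_compl.2 (mem_sdiff.1 hj).2
  · intro T hT
    refine union_sdiff_cancel_left ?_
    exact disjoint_right.2 fun j hj => mem_compl.1 (mem_powerset.1 hT hj)
  · intro U hU
    exact union_sdiff_of_subset (mem_filter.1 hU).2
  · intro T _
    rfl

/-- Khinchine type inequality for a homogeneous slice of coefficients. -/
theorem sqrt_sum_sq_rpow_le_sum_abs_rpow {ι : Type*} [Fintype ι] [DecidableEq ι] {p : ℝ}
    (hp1 : 1 < p) (hp2 : p < 2) {k d : ℕ} (c : Finset ι → ℝ)
    (hc : ∀ U, U.card ≠ d → c U = 0) (S : Finset ι) (hS : S.card = k) :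
    2 ^ Fintype.card ι * (√((p - 1) ^ (d - k)) * √(∑ U with S ⊆ U, c U ^ 2)) ^ p
      ≤ ∑ y : ι → Bool, |∑ T ∈ Sᶜ.powerset, c (S ∪ T) * walsh T y| ^ p := by
  have hp0 : 0 ≤ p - 1 := by linarith
  refine le_trans (le_of_eq ?_) (sum_sq_rpow_le_sum_abs_rpow hp1 hp2 Sᶜ fun T => c (S ∪ T))
  have h1 : ∑ T ∈ Sᶜ.powerset, (p - 1) ^ T.card * c (S ∪ T) ^ 2
      = (p - 1) ^ (d - k) * ∑ U with S ⊆ U, c U ^ 2 := by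
    rw [← sum_powerset_compl_union S fun U => c U ^ 2, mul_sum]
    refine sum_congr rfl fun T hT => ?_
    by_cases hcard : (S ∪ T).card = d
    · have hdisj : Disjoint S T :=
        disjoint_right.2 fun j hj => mem_compl.1 (mem_powerset.1 hT hj)
      rw [card_union_of_disjoint hdisj, hS] at hcard
      rw [← hcard, Nat.add_sub_cancel_left]
    · simp [hc _ hcard]
  have hnn : 0 ≤ ∑ U with S ⊆ U, c U ^ 2 := sum_nonneg fun U _ => sq_nonneg _
  rw [h1, ← Real.sqrt_mul (by positivity), Real.sqrt_eq_rpow, ← Real.rpow_mul (by positivity)]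
  congr 2
  ring

/-- Inductive step for the Boolean Bohnenblust–Hille inequality: if the BH inequality holds
with constant `B_k` for homogeneous functions of degree `k` (for all `n`), then it holds for
homogeneous functions of degree `d` with constant
`C(d,k)·B_k`, where `C(d,k) = ((k+1)/(k-1))^{(d-k)/2} (1+√2)^d d^d / (k^k (d-k)^{d-k})`. -/
theorem stmt8 (k d : ℕ) (hk : 1 < k) (hkd : k < d) (Bk : ℝ) (hBk : 0 ≤ Bk)
    (hyp : ∀ n : ℕ, 1 ≤ n → ∀ fhat : Finset (Fin n) → ℝ,
      (∀ S : Finset (Fin n), S.card ≠ k → fhat S = 0) →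
      (∑ S : Finset (Fin n), |fhat S| ^ ((2 * (k : ℝ)) / ((k : ℝ) + 1)))
          ^ (((k : ℝ) + 1) / (2 * (k : ℝ)))
        ≤ Bk * ⨆ x : Fin n → Bool,
            |∑ S : Finset (Fin n), fhat S * ∏ j ∈ S, (if x j then (1 : ℝ) else -1)|) :
    ∀ n : ℕ, 1 ≤ n → ∀ fhat : Finset (Fin n) → ℝ,
      (∀ S : Finset (Fin n), S.card ≠ d → fhat S = 0) →
      (∑ S : Finset (Fin n), |fhat S| ^ ((2 * (d : ℝ)) / ((d : ℝ) + 1)))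
          ^ (((d : ℝ) + 1) / (2 * (d : ℝ)))
        ≤ (((k : ℝ) + 1) / ((k : ℝ) - 1)) ^ (((d : ℝ) - (k : ℝ)) / 2)
            * ((1 + Real.sqrt 2) ^ d * (d : ℝ) ^ d
                / ((k : ℝ) ^ k * ((d - k : ℕ) : ℝ) ^ (d - k)))
            * Bk
            * ⨆ x : Fin n → Bool,
                |∑ S : Finset (Fin n), fhat S * ∏ j ∈ S, (if x j then (1 : ℝ) else -1)| := by
  intro n hn c hc
  let f : (Fin n → Bool) → ℝ := fun x => ∑ S, c S * walsh S x
  have hM : ∀ x, |f x| ≤ ⨆ x, |f x| := le_ciSup (Set.finite_range _).bddAbove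
  change _ ≤ _ * ⨆ x, |f x|
  set M := ⨆ x, |f x|
  have hM0 : 0 ≤ M := (abs_nonneg _).trans (hM fun _ => true)
  set K : ℝ := (1 + √2) ^ d * (d : ℝ) ^ d / ((k : ℝ) ^ k * ((d - k : ℕ) : ℝ) ^ (d - k)) with hK
  have hK0 : 0 ≤ K := by positivity
  have hk1 : (1 : ℝ) < k := by exact_mod_cast hk
  set p : ℝ := 2 * (k : ℝ) / ((k : ℝ) + 1) with hp
  have hp1 : 1 < p := by rw [hp, lt_div_iff₀ (by positivity)]; linarith
  have hp2 : p < 2 := by rw [hp, div_lt_iff₀ (by positivity)]; linarith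
  have hp0 : 0 < p := by linarith
  have hpinv : ((k : ℝ) + 1) / (2 * (k : ℝ)) = p⁻¹ := by rw [hp, inv_div]
  let g : Finset (Fin n) → (Fin n → Bool) → ℝ := fun S y =>
    ∑ T ∈ Sᶜ.powerset, c (S ∪ T) * walsh T y
  have hL0 : 0 ≤ Bk * (K * M) := by positivity
  have hslice : ∀ y, ∑ S ∈ powersetCard k univ, |g S y| ^ p ≤ (Bk * (K * M)) ^ p := by
    intro y
    have h1 := hyp n hn (fun S => if S.card = k then g S y else 0) fun S hS => if_neg hS
    have hsum : ∑ S : Finset (Fin n), |if S.card = k then g S y else 0| ^ p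
        = ∑ S ∈ powersetCard k univ, |g S y| ^ p := by
      rw [← sum_subset (subset_univ (powersetCard k univ))]
      · refine sum_congr rfl fun S hS => ?_
        rw [if_pos (mem_powersetCard.1 hS).2]
      · intro S _ hS
        rw [if_neg (by simpa [mem_powersetCard] using hS), abs_zero, Real.zero_rpow hp0.ne']
    have hsup : (⨆ x : Fin n → Bool, |∑ S : Finset (Fin n),
        (if S.card = k then g S y else 0) * ∏ j ∈ S, (if x j then (1 : ℝ) else -1)|) ≤ K * M := by
      refine ciSup_le fun x => ?_
      have h2 := abs_sum_walsh_mul_walsh_le (by omega) hkd c hc hM x y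
      refine le_trans (le_of_eq ?_) h2
      congr 1
      symm
      refine sum_subset_zero_on_sdiff (subset_univ _) (fun S hS => ?_) fun S hS => ?_
      · rw [if_neg (by simpa [mem_powersetCard] using hS), zero_mul]
      · rw [if_pos (mem_powersetCard.1 hS).2]
        rfl
    rw [hsum, hpinv] at h1
    have hnn : 0 ≤ ∑ S ∈ powersetCard k univ, |g S y| ^ p :=
      sum_nonneg fun S _ => Real.rpow_nonneg (abs_nonneg _) _
    exact (Real.rpow_inv_le_iff_of_pos hnn hL0 hp0).1
      (h1.trans (mul_le_mul_of_nonneg_left hsup hBk))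
  let A : Finset (Fin n) → ℝ := fun S => √(∑ U with S ⊆ U, c U ^ 2)
  have hA0 : ∀ S, 0 ≤ A S := fun S => Real.sqrt_nonneg _
  set ρ : ℝ := √((p - 1) ^ (d - k)) with hρ
  have hρ0 : 0 < ρ := Real.sqrt_pos.2 (pow_pos (by linarith) _)
  have hmean : ρ ^ p * ∑ S ∈ powersetCard k univ, A S ^ p ≤ (Bk * (K * M)) ^ p := by
    have h1 : ∑ S ∈ powersetCard k univ, (2 : ℝ) ^ Fintype.card (Fin n) * (ρ * A S) ^ p
        ≤ ∑ S ∈ powersetCard k univ, ∑ y, |g S y| ^ p := sum_le_sum fun S hS =>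
      sqrt_sum_sq_rpow_le_sum_abs_rpow hp1 hp2 c hc S (mem_powersetCard.1 hS).2
    rw [sum_comm, ← mul_sum] at h1
    have h2 := h1.trans (sum_le_sum fun y _ => hslice y)
    rw [sum_const, card_univ, Fintype.card_fun, Fintype.card_bool, nsmul_eq_mul] at h2
    push_cast at h2
    have h3 := le_of_mul_le_mul_left h2 (by positivity)
    rwa [sum_congr rfl fun S _ => Real.mul_rpow hρ0.le (hA0 S), ← mul_sum] at h3
  have hblei := sum_rpow_le_sum_sqrt_rpow hk.le hkd.le c hc
  rw [← hp, hpinv] at hblei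
  set E := ∑ S ∈ powersetCard k univ, A S ^ p with hE
  have hE0 : 0 ≤ E := sum_nonneg fun S _ => Real.rpow_nonneg (hA0 S) _
  have hroot : ρ * E ^ p⁻¹ ≤ Bk * (K * M) := by
    have := (Real.rpow_inv_le_iff_of_pos (by positivity) hL0 hp0).2 hmean
    rwa [Real.mul_rpow (by positivity) hE0, Real.rpow_rpow_inv hρ0.le hp0.ne'] at this
  have hρinv : (((k : ℝ) + 1) / ((k : ℝ) - 1)) ^ (((d : ℝ) - (k : ℝ)) / 2) = ρ⁻¹ := by
    have hpm : p - 1 = (((k : ℝ) + 1) / ((k : ℝ) - 1))⁻¹ := by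
      rw [hp, inv_div]; field_simp; ring
    have hq : 0 ≤ ((k : ℝ) + 1) / ((k : ℝ) - 1) := div_nonneg (by linarith) (by linarith)
    rw [hρ, hpm, inv_pow, Real.sqrt_inv, inv_inv, Real.sqrt_eq_rpow, ← Real.rpow_natCast,
      ← Real.rpow_mul hq, Nat.cast_sub hkd.le]
    congr 1
    ring
  rw [hρinv]
  refine hblei.trans ?_
  calc E ^ p⁻¹ = ρ⁻¹ * (ρ * E ^ p⁻¹) := by field_simp
    _ ≤ ρ⁻¹ * (Bk * (K * M)) := mul_le_mul_of_nonneg_left hroot (by positivity)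
    _ = _ := by ring
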